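/- Define the ⋈-convolution of f, g : S → ℤ/2ℤ by (f ⊛ g)(x) = Σ_{(y,z) : y ⋈ z = x} f(y) · g(z), where ⋈ acts componentwise. Then h⁽¹⁾ = ζ₁(f ⊛ g), and consequently f ⊛ g = μ₁ h⁽¹⁾. -/

import Mathlib

/-- The six states `𝟎, D, D*, C, C⁺, C*`. -/
inductive S0 : Type
  | O | D | Ds | C | Cp | Cs
  deriving DecidableEq

instance : Fintype S0 where
  elems := ⟨([.O, .D, .Ds, .C, .Cp, .Cs] : List S0), by decide⟩
  complete x := by cases x <;> decide

/-- The order `≤` on states, generated by `𝟎 < D < D* < C⁺ < C*` and `𝟎 < C < C⁺`. -/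
def le0 : S0 → S0 → Bool
  | .O, _ => true
  | .D, .D => true | .D, .Ds => true | .D, .Cp => true | .D, .Cs => true
  | .Ds, .Ds => true | .Ds, .Cp => true | .Ds, .Cs => true
  | .C, .C => true | .C, .Cp => true | .C, .Cs => true
  | .Cp, .Cp => true | .Cp, .Cs => true
  | .Cs, .Cs => true
  | _, _ => false

/-- The order `≤₁`: `a ≤₁ b` iff `a = b` or `b = C*`. -/
def le1 : S0 → S0 → Bool := fun a b => a == b || b == .Cs

/-- The order `≤₂`: `a ≤₂ b` iff `a = b`, or `b = C⁺` and `a ∈ {𝟎, D, D*, C}`, or `b = D*`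
and `a ∈ {𝟎, D}`, or `b = C` and `a = 𝟎`. -/
def le2 : S0 → S0 → Bool := fun a b =>
  a == b || (b == .Cp && (a == .O || a == .D || a == .Ds || a == .C)) ||
    (b == .Ds && (a == .O || a == .D)) || (b == .C && a == .O)

/-- The order `≤₃`: `a ≤₃ b` iff `a = b`, or `a = 𝟎` and `b = D`. -/
def le3 : S0 → S0 → Bool := fun a b => a == b || (a == .O && b == .D)

/-- The commutative join operation `⋈` on states. -/
def jn : S0 → S0 → S0
  | .O, a => a
  | a, .O => a
  | .Cs, _ => .Cs
  | _, .Cs => .Cs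
  | .D, .D => .Ds | .D, .Ds => .Ds | .Ds, .D => .Ds | .Ds, .Ds => .Ds
  | .D, .C => .Cp | .D, .Cp => .Cp | .Ds, .C => .Cp | .Ds, .Cp => .Cp
  | .C, .D => .Cp | .Cp, .D => .Cp | .C, .Ds => .Cp | .Cp, .Ds => .Cp
  | .C, .C => .Cs | .C, .Cp => .Cs | .Cp, .C => .Cs | .Cp, .Cp => .Cs

/-- The zeta matrix of the componentwise order induced by a base relation `r` on `S0`:
its `(x, y)` entry is `1` if `y ⊑ x` and `0` otherwise. -/
def zMat (k : ℕ) (r : S0 → S0 → Bool) : Matrix (Fin k → S0) (Fin k → S0) (ZMod 2) :=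
  Matrix.of fun x y => if ∀ q, r (y q) (x q) = true then 1 else 0

/-- The zeta transform `ζf(x) = Σ_{y ⊑ x} f(y)` of the componentwise order of `r`. -/
def zetaT (k : ℕ) (r : S0 → S0 → Bool) (f : (Fin k → S0) → ZMod 2) :
    (Fin k → S0) → ZMod 2 :=
  (zMat k r).mulVec f

/-- The Möbius transform of the componentwise order of `r`: the inverse of the zeta
transform. -/
noncomputable def muT (k : ℕ) (r : S0 → S0 → Bool) (f : (Fin k → S0) → ZMod 2) :
    (Fin k → S0) → ZMod 2 :=
  (zMat k r)⁻¹.mulVec f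

/-- The number of coordinates of `x` whose state is in `classC = {C, C⁺}`. -/
def cardC (k : ℕ) (x : Fin k → S0) : ℕ :=
  (Finset.univ.filter fun q => x q = S0.C ∨ x q = S0.Cp).card

/-- The number of coordinates of `x` whose state is in `classD = {D}`. -/
def cardD (k : ℕ) (x : Fin k → S0) : ℕ :=
  (Finset.univ.filter fun q => x q = S0.D).card

/-- The number of coordinates where both `x` and `y` have a state in `classC`. -/
def cardCC (k : ℕ) (x y : Fin k → S0) : ℕ :=
  (Finset.univ.filter fun q => (x q = S0.C ∨ x q = S0.Cp) ∧ (y q = S0.C ∨ y q = S0.Cp)).card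

/-- The number of coordinates where both `x` and `y` have state `D`. -/
def cardDD (k : ℕ) (x y : Fin k → S0) : ℕ :=
  (Finset.univ.filter fun q => x q = S0.D ∧ y q = S0.D).card

/-- The filter `f|ᵢ^{classC}`. -/
def restrC (k : ℕ) (i : ℕ) (f : (Fin k → S0) → ZMod 2) : (Fin k → S0) → ZMod 2 :=
  fun x => if cardC k x = i then f x else 0

/-- The filter `f|ⱼ^{classD}`. -/
def restrD (k : ℕ) (j : ℕ) (f : (Fin k → S0) → ZMod 2) : (Fin k → S0) → ZMod 2 :=
  fun x => if cardD k x = j then f x else 0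

/-- `f⁽³⁾_{i,j} = ζ₃ ((ζ₂ ((ζ₁ f)|ᵢ^{classC}))|ⱼ^{classD})`. -/
def F3 (k : ℕ) (f : (Fin k → S0) → ZMod 2) (i j : ℕ) : (Fin k → S0) → ZMod 2 :=
  zetaT k le3 (restrD k j (zetaT k le2 (restrC k i (zetaT k le1 f))))

/-- `h⁽³⁾_{i,j} = Σ_{i₁+i₂=i, j₁+j₂=j} f⁽³⁾_{i₁,j₁} · g⁽³⁾_{i₂,j₂}` (pointwise product). -/
def H3 (k : ℕ) (f g : (Fin k → S0) → ZMod 2) (i j : ℕ) : (Fin k → S0) → ZMod 2 :=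
  fun x => ∑ a ∈ Finset.HasAntidiagonal.antidiagonal i, ∑ b ∈ Finset.HasAntidiagonal.antidiagonal j,
    F3 k f a.1 b.1 x * F3 k g a.2 b.2 x

/-- `h⁽²⁾_{i,j} = μ₃ h⁽³⁾_{i,j}`. -/
noncomputable def H2 (k : ℕ) (f g : (Fin k → S0) → ZMod 2) (i j : ℕ) :
    (Fin k → S0) → ZMod 2 :=
  muT k le3 (H3 k f g i j)

/-- `h⁽²⁾ᵢ(x) = h⁽²⁾_{i,j}(x)` for `j = |{q : x_q = D}|`. -/
noncomputable def H2i (k : ℕ) (f g : (Fin k → S0) → ZMod 2) (i : ℕ) :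
    (Fin k → S0) → ZMod 2 :=
  fun x => H2 k f g i (cardD k x) x

/-- `h⁽¹⁾ᵢ = μ₂ h⁽²⁾ᵢ`. -/
noncomputable def H1i (k : ℕ) (f g : (Fin k → S0) → ZMod 2) (i : ℕ) :
    (Fin k → S0) → ZMod 2 :=
  muT k le2 (H2i k f g i)

/-- `h⁽¹⁾(x) = h⁽¹⁾ᵢ(x)` for `i = |{q : x_q ∈ classC}|`. -/
noncomputable def H1 (k : ℕ) (f g : (Fin k → S0) → ZMod 2) : (Fin k → S0) → ZMod 2 :=
  fun x => H1i k f g (cardC k x) x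

/-- The `⋈`-convolution `(f ⊛ g)(x) = Σ_{y ⋈ z = x} f(y) · g(z)`, with `⋈` acting
componentwise. -/
def conv (k : ℕ) (f g : (Fin k → S0) → ZMod 2) : (Fin k → S0) → ZMod 2 :=
  fun x => ∑ y : Fin k → S0, ∑ z : Fin k → S0,
    if ∀ q, jn (y q) (z q) = x q then f y * g z else 0

section PiPow

open Matrix
open scoped Kronecker

variable {R l m n l' m' : Type*} [CommRing R] {k : ℕ}

/-- The `k`-fold Kronecker power of a matrix, indexed by words of length `k`. -/
def piPow (k : ℕ) (A : Matrix m n R) : Matrix (Fin k → m) (Fin k → n) R :=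
  Matrix.of fun x y => ∏ q, A (x q) (y q)

theorem piPow_apply (A : Matrix m n R) (x : Fin k → m) (y : Fin k → n) :
    piPow k A x y = ∏ q, A (x q) (y q) := rfl

theorem piPow_mul [Fintype m] (A : Matrix l m R) (B : Matrix m n R) :
    piPow k (A * B) = piPow k A * piPow k B := by
  classical
  ext x y
  simp only [piPow_apply, Matrix.mul_apply, ← Finset.prod_mul_distrib]
  rw [Finset.prod_univ_sum, Fintype.piFinset_univ]

theorem piPow_one [DecidableEq m] : piPow k (1 : Matrix m m R) = 1 := by
  ext x y
  simp only [piPow_apply, Matrix.one_apply, Finset.prod_ite_zero, Finset.prod_const_one,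
    Finset.mem_univ, true_implies, funext_iff]

theorem piPow_inv_mul [Fintype m] [DecidableEq m] {A B : Matrix m m R} (h : B * A = 1) :
    (piPow k A)⁻¹ * piPow k A = 1 := by
  have h' : piPow k B * piPow k A = 1 := by rw [← piPow_mul, h, piPow_one]
  rw [Matrix.inv_eq_left_inv h', h']

/-- The external product of functions on words, as a function on words over pairs. -/
def extProd (f : (Fin k → m) → R) (g : (Fin k → n) → R) : (Fin k → m × n) → R :=
  fun p => f (fun q => (p q).1) * g (fun q => (p q).2)

theorem sum_pair_word [Fintype m] [Fintype n] (F : (Fin k → m × n) → R) :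
    ∑ p, F p = ∑ y : Fin k → m, ∑ z : Fin k → n, F fun q => (y q, z q) := by
  rw [← Fintype.sum_prod_type']
  exact Fintype.sum_equiv (Equiv.arrowProdEquivProdArrow (Fin k) (fun _ => m) (fun _ => n))
    _ _ fun _ => rfl

theorem extProd_mulVec [Fintype m] [Fintype m'] (A : Matrix l m R) (B : Matrix l' m' R)
    (f : (Fin k → m) → R) (g : (Fin k → m') → R) :
    extProd (piPow k A *ᵥ f) (piPow k B *ᵥ g) = piPow k (A ⊗ₖ B) *ᵥ extProd f g := by
  ext p
  simp only [extProd, Matrix.mulVec, dotProduct, sum_pair_word, piPow_apply, kroneckerMap_apply,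
    Finset.sum_mul_sum, Finset.prod_mul_distrib]
  exact Finset.sum_congr rfl fun y _ => Finset.sum_congr rfl fun z _ => by ring

/-- The total weight of a word. -/
def wordWeight (w : m → ℕ) (x : Fin k → m) : ℕ := ∑ q, w (x q)

/-- The restriction of a function to the words of a given weight. -/
def restrWeight (w : m → ℕ) (i : ℕ) (f : (Fin k → m) → R) : (Fin k → m) → R :=
  fun x => if wordWeight w x = i then f x else 0

theorem sum_antidiagonal_extProd_restrWeight (w : m → ℕ) (i : ℕ) (f g : (Fin k → m) → R) :
    ∑ a ∈ Finset.HasAntidiagonal.antidiagonal i,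
        extProd (restrWeight w a.1 f) (restrWeight w a.2 g) =
      restrWeight (fun p : m × m => w p.1 + w p.2) i (extProd f g) := by
  ext p
  set u := wordWeight w fun q => (p q).1 with hu
  set v := wordWeight w fun q => (p q).2 with hv
  have huv : wordWeight (fun p : m × m => w p.1 + w p.2) p = u + v := Finset.sum_add_distrib
  simp only [Finset.sum_apply, restrWeight, extProd, huv, ← hu, ← hv]
  split_ifs with h
  · rw [Finset.sum_eq_single (u, v)]
    · simp
    · rintro ⟨a, b⟩ - hab
      by_cases ha : u = a
      · by_cases hb : v = b
        · exact absurd (by rw [ha, hb]) hab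
        · simp [hb]
      · simp [ha]
    · exact fun h' => absurd (Finset.HasAntidiagonal.mem_antidiagonal.2 h) h'
  · refine Finset.sum_eq_zero fun a ha => ?_
    rw [Finset.HasAntidiagonal.mem_antidiagonal] at ha
    by_cases h1 : u = a.1
    · have h2 : v ≠ a.2 := fun h2 => h (by rw [h1, h2, ha])
      simp [h2]
    · simp [h1]

/-- If the entries of `U` never lower the weight, then keeping only the weight-preserving part of
its power amounts to keeping the weight-preserving entries of `U`. -/
theorem piPow_mulVec_restrWeight [Fintype n] (w : m → ℕ) (v : n → ℕ) (U T' : Matrix m n R)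
    (hle : ∀ c p, U c p ≠ 0 → w c ≤ v p)
    (hT' : ∀ c p, T' c p = if v p = w c then U c p else 0)
    (F : (Fin k → n) → R) (x : Fin k → m) :
    (piPow k U *ᵥ restrWeight v (wordWeight w x) F) x = (piPow k T' *ᵥ F) x := by
  simp only [Matrix.mulVec, dotProduct, piPow_apply, restrWeight, hT', Finset.prod_ite_zero,
    Finset.mem_univ, true_implies]
  refine Finset.sum_congr rfl fun y _ => ?_
  by_cases h0 : ∀ q, U (x q) (y q) ≠ 0
  · have key : wordWeight v y = wordWeight w x ↔ ∀ q, v (y q) = w (x q) := by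
      have := Finset.sum_eq_sum_iff_of_le
        (fun q (_ : q ∈ Finset.univ) => hle (x q) (y q) (h0 q))
      simp only [Finset.mem_univ, true_implies] at this
      rw [eq_comm, wordWeight, wordWeight, this]
      exact forall_congr' fun q => eq_comm
    simp only [key, mul_ite, mul_zero, ite_mul, zero_mul]
  · push Not at h0
    obtain ⟨q, hq⟩ := h0
    have hp : ∏ q, U (x q) (y q) = 0 := Finset.prod_eq_zero (Finset.mem_univ q) hq
    simp [hp]

/-- One level of the ranked transform: the ranked product in the `Z`-domain computes the
weight-preserving part of the product whose `Z`-transform it is. -/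
theorem inv_mulVec_rankedProduct [Fintype m] [DecidableEq m] (w : m → ℕ)
    {Z M : Matrix m m R} {T U T' : Matrix m (m × m) R}
    (hM : M * Z = 1) (hU : Z * U = T * (Z ⊗ₖ Z))
    (hle : ∀ c p, U c p ≠ 0 → w c ≤ w p.1 + w p.2)
    (hT' : ∀ c p, T' c p = if w p.1 + w p.2 = w c then U c p else 0)
    (f g : (Fin k → m) → R) (x : Fin k → m) :
    ((piPow k Z)⁻¹ *ᵥ ∑ a ∈ Finset.HasAntidiagonal.antidiagonal (wordWeight w x),
      piPow k T *ᵥ extProd (piPow k Z *ᵥ restrWeight w a.1 f) (piPow k Z *ᵥ restrWeight w a.2 g)) x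
      = (piPow k T' *ᵥ extProd f g) x := by
  simp only [extProd_mulVec, Matrix.mulVec_mulVec, ← piPow_mul, ← hU]
  rw [← Matrix.mulVec_sum, sum_antidiagonal_extProd_restrWeight, piPow_mul, Matrix.mulVec_mulVec,
    ← Matrix.mul_assoc, piPow_inv_mul hM, Matrix.one_mul]
  exact piPow_mulVec_restrWeight w (fun p : m × m => w p.1 + w p.2) U T' hle hT' _ x

end PiPow

section States

open Matrix
open scoped Kronecker

/-- The zeta matrix of a relation on the states. -/
def stateZeta (r : S0 → S0 → Bool) : Matrix S0 S0 (ZMod 2) :=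
  Matrix.of fun a b => if r b a = true then 1 else 0

/-- The `0`-`1` matrix of a partial binary operation on the states. -/
def opMat (t : S0 → S0 → Option S0) : Matrix S0 (S0 × S0) (ZMod 2) :=
  Matrix.of fun c p => if t p.1 p.2 = some c then 1 else 0

/-- The partial operation `a, a ↦ a` of the pointwise product. -/
def diagOp (a b : S0) : Option S0 := if a = b then some a else none

/-- The join for the order `≤₃`. -/
def joinThree (a b : S0) : Option S0 :=
  if le3 a b then some b else if le3 b a then some a else none

/-- The part of `joinThree` preserving the number of states `D`. -/
def rankedThree (a b : S0) : Option S0 :=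
  if a = .D ∧ b = .D then none else joinThree a b

/-- The product on states whose `ζ₂`-transform is `rankedThree`. -/
def joinTwo (a b : S0) : Option S0 :=
  if a = .C ∧ b = .C then some .C
  else if a = .Cs ∨ b = .Cs then diagOp a b
  else if jn a b = .Cs then some .Cp
  else some (jn a b)

/-- The part of `joinTwo` preserving the number of states in `classC`. -/
def rankedTwo (a b : S0) : Option S0 :=
  if a = .Cs ∨ b = .Cs then diagOp a b
  else if jn a b = .Cs then none
  else some (jn a b)

/-- The indicator of `classC` as a weight. -/
def weightC (a : S0) : ℕ := if a = .C ∨ a = .Cp then 1 else 0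

/-- The indicator of `classD` as a weight. -/
def weightD (a : S0) : ℕ := if a = .D then 1 else 0

theorem stateZeta_pow_four (r : S0 → S0 → Bool) (hr : r = le1 ∨ r = le2 ∨ r = le3) :
    (stateZeta r * stateZeta r) * (stateZeta r * stateZeta r) = 1 := by
  ext i j
  rw [Matrix.one_apply]
  revert i j
  rcases hr with rfl | rfl | rfl <;> decide +kernel

theorem stateZeta_cube_mul (r : S0 → S0 → Bool) (hr : r = le1 ∨ r = le2 ∨ r = le3) :
    (stateZeta r * stateZeta r * stateZeta r) * stateZeta r = 1 := by
  rw [Matrix.mul_assoc, stateZeta_pow_four r hr]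

theorem stateZeta_mul_joinThree :
    stateZeta le3 * opMat joinThree = opMat diagOp * (stateZeta le3 ⊗ₖ stateZeta le3) := by
  rw [← Matrix.ext_iff]
  decide +kernel

theorem stateZeta_mul_joinTwo :
    stateZeta le2 * opMat joinTwo = opMat rankedThree * (stateZeta le2 ⊗ₖ stateZeta le2) := by
  rw [← Matrix.ext_iff]
  decide +kernel

theorem stateZeta_mul_jn :
    stateZeta le1 * opMat (fun a b => some (jn a b)) =
      opMat rankedTwo * (stateZeta le1 ⊗ₖ stateZeta le1) := by
  rw [← Matrix.ext_iff]
  decide +kernel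

theorem weightD_le_of_joinThree (c : S0) (p : S0 × S0) (h : opMat joinThree c p ≠ 0) :
    weightD c ≤ weightD p.1 + weightD p.2 := by
  revert c p
  simp only [opMat, Matrix.of_apply]
  decide +kernel

theorem opMat_rankedThree (c : S0) (p : S0 × S0) :
    opMat rankedThree c p =
      if weightD p.1 + weightD p.2 = weightD c then opMat joinThree c p else 0 := by
  revert c p
  simp only [opMat, Matrix.of_apply]
  decide +kernel

theorem weightC_le_of_joinTwo (c : S0) (p : S0 × S0) (h : opMat joinTwo c p ≠ 0) :
    weightC c ≤ weightC p.1 + weightC p.2 := by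
  revert c p
  simp only [opMat, Matrix.of_apply]
  decide +kernel

theorem opMat_rankedTwo (c : S0) (p : S0 × S0) :
    opMat rankedTwo c p =
      if weightC p.1 + weightC p.2 = weightC c then opMat joinTwo c p else 0 := by
  revert c p
  simp only [opMat, Matrix.of_apply]
  decide +kernel

theorem zMat_eq_piPow (k : ℕ) (r : S0 → S0 → Bool) : zMat k r = piPow k (stateZeta r) := by
  ext x y
  simp [zMat, piPow_apply, stateZeta, Finset.prod_ite_zero]

theorem zetaT_eq (k : ℕ) (r : S0 → S0 → Bool) (f : (Fin k → S0) → ZMod 2) :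
    zetaT k r f = piPow k (stateZeta r) *ᵥ f := by
  rw [zetaT, zMat_eq_piPow]

theorem cardC_eq (k : ℕ) (x : Fin k → S0) : cardC k x = wordWeight weightC x :=
  Finset.card_filter _ _

theorem restrC_eq (k i : ℕ) (f : (Fin k → S0) → ZMod 2) :
    restrC k i f = restrWeight weightC i f := by
  ext x
  simp only [restrC, restrWeight, cardC_eq]

theorem cardD_eq (k : ℕ) (x : Fin k → S0) : cardD k x = wordWeight weightD x :=
  Finset.card_filter _ _

theorem restrD_eq (k i : ℕ) (f : (Fin k → S0) → ZMod 2) :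
    restrD k i f = restrWeight weightD i f := by
  ext x
  simp only [restrD, restrWeight, cardD_eq]

theorem conv_eq (k : ℕ) (f g : (Fin k → S0) → ZMod 2) :
    conv k f g = piPow k (opMat fun a b => some (jn a b)) *ᵥ extProd f g := by
  ext x
  simp [conv, Matrix.mulVec, dotProduct, sum_pair_word, piPow_apply, opMat, extProd,
    Finset.prod_ite_zero]

theorem mul_eq_diagOp (k : ℕ) (f g : (Fin k → S0) → ZMod 2) :
    f * g = piPow k (opMat diagOp) *ᵥ extProd f g := by
  ext x
  have h (a b c : S0) : diagOp a b = some c ↔ a = c ∧ b = c := by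
    revert a b c
    decide
  simp [Matrix.mulVec, dotProduct, sum_pair_word, piPow_apply, opMat, extProd,
    Finset.prod_ite_zero, h, ← funext_iff, ite_and]

theorem H2i_eq (k : ℕ) (f g : (Fin k → S0) → ZMod 2) (i : ℕ) :
    H2i k f g i = ∑ a ∈ Finset.HasAntidiagonal.antidiagonal i, piPow k (opMat rankedThree) *ᵥ
      extProd (zetaT k le2 (restrC k a.1 (zetaT k le1 f)))
        (zetaT k le2 (restrC k a.2 (zetaT k le1 g))) := by
  ext x
  have hH3 (j : ℕ) : H3 k f g i j =
      ∑ a ∈ Finset.HasAntidiagonal.antidiagonal i, ∑ b ∈ Finset.HasAntidiagonal.antidiagonal j,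
        F3 k f a.1 b.1 * F3 k g a.2 b.2 := by
    ext y
    simp [H3]
  rw [H2i, H2, hH3, muT, Matrix.mulVec_sum, Finset.sum_apply, Finset.sum_apply]
  refine Finset.sum_congr rfl fun a _ => ?_
  simp only [mul_eq_diagOp, F3, restrD_eq, cardD_eq]
  simp only [zetaT_eq k le3, zMat_eq_piPow k le3]
  exact inv_mulVec_rankedProduct weightD (stateZeta_cube_mul le3 (by simp))
    stateZeta_mul_joinThree weightD_le_of_joinThree opMat_rankedThree _ _ x

theorem H1_eq (k : ℕ) (f g : (Fin k → S0) → ZMod 2) :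
    H1 k f g = piPow k (opMat rankedTwo) *ᵥ extProd (zetaT k le1 f) (zetaT k le1 g) := by
  ext x
  simp only [H1, H1i, H2i_eq, muT, restrC_eq, cardC_eq]
  simp only [zetaT_eq k le2, zMat_eq_piPow k le2]
  exact inv_mulVec_rankedProduct weightC (stateZeta_cube_mul le2 (by simp))
    stateZeta_mul_joinTwo weightC_le_of_joinTwo opMat_rankedTwo _ _ x

end States

/-- `h⁽¹⁾ = ζ₁(f ⊛ g)`, and consequently `f ⊛ g = μ₁ h⁽¹⁾`. -/
theorem H1_eq_zeta_conv (k : ℕ) (f g : (Fin k → S0) → ZMod 2) :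
    H1 k f g = zetaT k le1 (conv k f g) ∧ conv k f g = muT k le1 (H1 k f g) := by
  have h : H1 k f g = zetaT k le1 (conv k f g) := by
    rw [H1_eq, conv_eq, zetaT_eq, zetaT_eq, zetaT_eq, extProd_mulVec, Matrix.mulVec_mulVec,
      Matrix.mulVec_mulVec, ← piPow_mul, ← piPow_mul, stateZeta_mul_jn]
  refine ⟨h, ?_⟩
  rw [h, muT, zetaT_eq, zMat_eq_piPow, Matrix.mulVec_mulVec,
    piPow_inv_mul (stateZeta_cube_mul le1 (by simp)), Matrix.one_mulVec]
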